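/- There exists a universal constant C > 0 such that for every K = 2^k ≥ 2, every m, every 0 ≤ j ≤ m−2, and every pair of boxes B₁, B₂ ∈ BD_{K^{j−1}}, letting A denote the union of all tame paths P ∈ SL_{j+1} with x_P ∈ B₁ and y_P ∈ B₂ (assuming at least one such path exists), the following hold: (1) |A ∩ ℤ²| ≤ C·K^{2j+1}; (2) min(Â₁, Â₂) ≤ C·K^j, where Â₁ = max_{a∈ℤ} |{b : (a,b) ∈ A ∩ ℤ²}| and Â₂ = max_{b∈ℤ} |{a : (a,b) ∈ A ∩ ℤ²}|; (3) the number of boxes in BD_{K^j} that intersect A is at most C·K; and (4) writing D̃ for the set of points K^{−j}·l_B where B ranges over boxes of BD_{K^j} intersecting A and l_B is the lower-left lattice corner of B, one has min(D̃₁, D̃₂) ≤ C, with D̃₁, D̃₂ the maximal column and row counts of D̃. -/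

import Mathlib

open MeasureTheory ProbabilityTheory Real Set Filter

/-- The lattice ℤ². -/
abbrev Z2 := ℤ × ℤ

/-- Nearest-neighbor adjacency on ℤ². -/
def Adj (x y : Z2) : Prop := |x.1 - y.1| + |x.2 - y.2| = 1

/-- The `L^∞` distance on ℤ². -/
def linf (x y : Z2) : ℤ := max |x.1 - y.1| |x.2 - y.2|

/-- The Euclidean distance on ℤ². -/
noncomputable def eZ (x y : Z2) : ℝ :=
  Real.sqrt (((x.1 - y.1 : ℤ) : ℝ) ^ 2 + ((x.2 - y.2 : ℤ) : ℝ) ^ 2)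

/-- A lattice path viewed as a continuous curve in ℝ², parametrized at unit speed
along the unit edges of ℤ², allowed to start and end at interior points of edges.
`v n` is the lattice vertex occupied at integer time `n`; the curve is defined on
the time interval `[a, b]`, and consecutive vertices are nearest neighbors. -/
structure GridPath where
  a : ℝ
  b : ℝ
  hab : a ≤ b
  v : ℤ → Z2
  adj : ∀ n : ℤ, a < (n : ℝ) + 1 → (n : ℝ) < b → Adj (v n) (v (n + 1))

/-- The point of the curve at time `t` (affine interpolation along edges). -/
noncomputable def GridPath.pt (P : GridPath) (t : ℝ) : ℝ × ℝ :=
  (((P.v ⌊t⌋).1 : ℝ) + (t - ⌊t⌋) * (((P.v (⌊t⌋ + 1)).1 : ℝ) - ((P.v ⌊t⌋).1 : ℝ)),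
   ((P.v ⌊t⌋).2 : ℝ) + (t - ⌊t⌋) * (((P.v (⌊t⌋ + 1)).2 : ℝ) - ((P.v ⌊t⌋).2 : ℝ)))

/-- The starting point `x_P` of the path. -/
noncomputable def GridPath.start (P : GridPath) : ℝ × ℝ := P.pt P.a

/-- The ending point `y_P` of the path. -/
noncomputable def GridPath.fin (P : GridPath) : ℝ × ℝ := P.pt P.b

/-- The image (trace) of the path in ℝ². -/
noncomputable def GridPath.image (P : GridPath) : Set (ℝ × ℝ) := P.pt '' Set.Icc P.a P.b

/-- Euclidean distance on ℝ². -/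
noncomputable def e2 (p q : ℝ × ℝ) : ℝ := Real.sqrt ((p.1 - q.1) ^ 2 + (p.2 - q.2) ^ 2)

/-- `‖P‖`, the Euclidean distance between the endpoints of `P`. -/
noncomputable def GridPath.norm (P : GridPath) : ℝ := e2 P.start P.fin

/-- The closed Euclidean ball `B(c, r)` in ℝ². -/
def cball (c : ℝ × ℝ) (r : ℝ) : Set (ℝ × ℝ) := {p | e2 c p ≤ r}

/-- A lattice point of ℤ² as a point of ℝ². -/
def castZ (z : Z2) : ℝ × ℝ := ((z.1 : ℝ), (z.2 : ℝ))

/-- The set of lattice points visited by the path. -/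
noncomputable def GridPath.lattice (P : GridPath) : Set Z2 := {z | castZ z ∈ P.image}

/-- `Q` is a subpath of `P`. -/
def SubPath (Q P : GridPath) : Prop :=
  P.a ≤ Q.a ∧ Q.b ≤ P.b ∧ ∀ t ∈ Set.Icc Q.a Q.b, Q.pt t = P.pt t

/-- Two paths are disjoint if, after removing their endpoints, their traces are
disjoint subsets of ℝ². -/
def PathDisj (P Q : GridPath) : Prop :=
  (P.image \ {P.start, P.fin}) ∩ (Q.image \ {Q.start, Q.fin}) = ∅

/-- The class `SL_j` of paths in scale `K^j` (for `1 ≤ j ≤ m-1`):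
`K^j ≤ ‖P‖ ≤ (1 + 1/K) K^j` and `P ⊆ B(x_P, ‖P‖)`. -/
def SL (K j : ℕ) : Set GridPath :=
  {P | (K : ℝ) ^ j ≤ P.norm ∧ P.norm ≤ (1 + 1 / (K : ℝ)) * (K : ℝ) ^ j ∧
    P.image ⊆ cball P.start P.norm}

/-- The closed box of `BD_r` indexed by `(i₁, i₂) ∈ ℤ²`:
`[i₁ r - 1/2, (i₁+1) r - 1/2] × [i₂ r - 1/2, (i₂+1) r - 1/2]`. -/
def BDbox (r : ℝ) (i : Z2) : Set (ℝ × ℝ) :=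
  {p | (i.1 : ℝ) * r - 1 / 2 ≤ p.1 ∧ p.1 ≤ ((i.1 : ℝ) + 1) * r - 1 / 2 ∧
       (i.2 : ℝ) * r - 1 / 2 ≤ p.2 ∧ p.2 ≤ ((i.2 : ℝ) + 1) * r - 1 / 2}

/-- The ellipse `E(P) = {z : ‖x_P - z‖ + ‖y_P - z‖ ≤ (1 + 2/K²) ‖P‖}`. -/
noncomputable def ellipse (K : ℕ) (P : GridPath) : Set (ℝ × ℝ) :=
  {z | e2 P.start z + e2 P.fin z ≤ (1 + 2 / (K : ℝ) ^ 2) * P.norm}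

/-- A path `P ∈ SL_{j+1}` is tame if `P ⊆ Ẽ(P)`, where `Ẽ(P)` is the closed
`4 K^j`-neighborhood of the (compact) ellipse `E(P)`. -/
noncomputable def Tame (K j : ℕ) (P : GridPath) : Prop :=
  ∀ p ∈ P.image, ∃ w ∈ ellipse K P, e2 p w ≤ 4 * (K : ℝ) ^ j

/-- The union `A` of all tame paths `P ∈ SL_{j+1}` with `x_P ∈ B₁` and `y_P ∈ B₂`,
where `B₁, B₂` are the boxes of `BD_{K^{j-1}}` indexed by `i₁, i₂ ∈ ℤ²`. -/
noncomputable def tameUnion (K j : ℕ) (i₁ i₂ : Z2) : Set (ℝ × ℝ) :=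
  {p | ∃ P : GridPath, P ∈ SL K (j + 1) ∧ Tame K j P ∧
    P.start ∈ BDbox ((K : ℝ) ^ j / (K : ℝ)) i₁ ∧
    P.fin ∈ BDbox ((K : ℝ) ^ j / (K : ℝ)) i₂ ∧ p ∈ P.image}

lemma count1 {α : Type*} (T : Set α) (g : α → ℤ) (hg : Set.InjOn g T) (L : ℝ)
    (h : ∀ z ∈ T, ∀ w ∈ T, |(g z : ℝ) - g w| ≤ L) :
    T.Finite ∧ Set.ncard T ≤ 2 * ⌊L⌋₊ + 1 := by
  rcases T.eq_empty_or_nonempty with rfl | ⟨z0, hz0⟩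
  · simp
  have hsub : g '' T ⊆ ((Finset.Icc (g z0 - ⌊L⌋₊) (g z0 + ⌊L⌋₊) : Finset ℤ) : Set ℤ) := by
    rintro _ ⟨z, hz, rfl⟩
    have h1 := h z hz z0 hz0
    have h2 : ((g z - g z0).natAbs : ℝ) ≤ L := by
      rw [Nat.cast_natAbs]; push_cast; exact h1
    have h3 := Nat.le_floor h2
    rw [Finset.coe_Icc, Set.mem_Icc]
    omega
  have hfin : (g '' T).Finite := (Finset.finite_toSet _).subset hsub
  refine ⟨Set.Finite.of_finite_image hfin hg, ?_⟩
  rw [← Set.InjOn.ncard_image hg]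
  refine (Set.ncard_le_ncard hsub (Finset.finite_toSet _)).trans ?_
  rw [Set.ncard_coe_finset, Int.card_Icc]
  omega

lemma count2 {α : Type*} (T : Set α) (f g : α → ℤ)
    (hinj : ∀ z w, f z = f w → g z = g w → z = w) (K ρ : ℝ) (hK : 1 ≤ K) (hρ : 1 ≤ ρ)
    (h1 : ∀ z ∈ T, ∀ w ∈ T, |(g z : ℝ) - g w| ≤ 201 * (ρ + |(f z : ℝ) - f w|))
    (h2 : ∀ z ∈ T, ∀ w ∈ T, |(f z : ℝ) - f w| ≤ 201 * (K * ρ)) :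
    (Set.ncard T : ℝ) ≤ 200000 * (K * ρ ^ 2) ∧
    ∀ a : ℤ, (Set.ncard {z | z ∈ T ∧ f z = a} : ℝ) ≤ 200000 * ρ := by
  classical
  have hKρ : 1 ≤ K * ρ := by nlinarith
  have hfib : ∀ a : ℤ, ({z | z ∈ T ∧ f z = a}).Finite ∧
      Set.ncard {z | z ∈ T ∧ f z = a} ≤ 2 * ⌊201 * ρ⌋₊ + 1 := by
    intro a
    refine count1 _ g ?_ _ ?_
    · rintro z ⟨_, hz⟩ w ⟨_, hw⟩ hzw
      exact hinj z w (hz.trans hw.symm) hzw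
    · rintro z ⟨hz, hz'⟩ w ⟨hw, hw'⟩
      have := h1 z hz w hw
      rw [hz', hw'] at this
      simpa using this
  have hb : ((2 * ⌊201 * ρ⌋₊ + 1 : ℕ) : ℝ) ≤ 403 * ρ := by
    push_cast
    have := Nat.floor_le (a := 201 * ρ) (by linarith)
    linarith
  have hb2 : ((2 * ⌊201 * (K * ρ)⌋₊ + 1 : ℕ) : ℝ) ≤ 403 * (K * ρ) := by
    push_cast
    have := Nat.floor_le (a := 201 * (K * ρ)) (by linarith)
    linarith
  have himg := count1 (f '' T) id Function.injective_id.injOn (201 * (K * ρ)) (by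
    rintro _ ⟨z, hz, rfl⟩ _ ⟨w, hw, rfl⟩
    exact h2 z hz w hw)
  have hTfin : T.Finite := by
    have : T ⊆ ⋃ a ∈ f '' T, {z | z ∈ T ∧ f z = a} := by
      intro z hz
      simp only [Set.mem_iUnion]
      exact ⟨f z, ⟨z, hz, rfl⟩, hz, rfl⟩
    exact (himg.1.biUnion (fun a _ => (hfib a).1)).subset this
  constructor
  · have hc := Finset.card_le_mul_card_image (f := f) hTfin.toFinset (2 * ⌊201 * ρ⌋₊ + 1) (by
      intro a _
      refine le_trans (le_of_eq ?_) (hfib a).2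
      rw [← Set.ncard_coe_finset]
      congr 1
      ext z; simp)
    have hc2 : (hTfin.toFinset.image f).card ≤ 2 * ⌊201 * (K * ρ)⌋₊ + 1 := by
      refine le_trans (le_of_eq ?_) himg.2
      rw [← Set.ncard_coe_finset]
      congr 1
      ext z; simp
    rw [Set.ncard_eq_toFinset_card T hTfin]
    have h3 : (hTfin.toFinset.card : ℝ) ≤ ((2 * ⌊201 * ρ⌋₊ + 1 : ℕ) : ℝ) *
        ((2 * ⌊201 * (K * ρ)⌋₊ + 1 : ℕ) : ℝ) := by
      exact_mod_cast hc.trans (Nat.mul_le_mul_left _ hc2)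
    refine h3.trans ?_
    calc _ ≤ (403 * ρ) * (403 * (K * ρ)) := by gcongr
      _ ≤ _ := by nlinarith [mul_nonneg (sub_nonneg.2 hK) (sq_nonneg ρ), sq_nonneg ρ]
  · intro a
    have : (Set.ncard {z | z ∈ T ∧ f z = a} : ℝ) ≤ ((2 * ⌊201 * ρ⌋₊ + 1 : ℕ) : ℝ) := by
      exact_mod_cast (hfib a).2
    linarith

lemma abs1_le_e2 (p q : ℝ × ℝ) : |p.1 - q.1| ≤ e2 p q := by
  apply Real.abs_le_sqrt; nlinarith [sq_nonneg (p.2 - q.2)]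

lemma abs2_le_e2 (p q : ℝ × ℝ) : |p.2 - q.2| ≤ e2 p q := by
  apply Real.abs_le_sqrt; nlinarith [sq_nonneg (p.1 - q.1)]

lemma e2_le_add (p q : ℝ × ℝ) : e2 p q ≤ |p.1 - q.1| + |p.2 - q.2| := by
  apply Real.sqrt_le_iff.2
  refine ⟨by positivity, ?_⟩
  nlinarith [sq_abs (p.1 - q.1), sq_abs (p.2 - q.2),
    mul_nonneg (abs_nonneg (p.1 - q.1)) (abs_nonneg (p.2 - q.2))]

lemma e2_sq (p q : ℝ × ℝ) : e2 p q ^ 2 = (p.1 - q.1) ^ 2 + (p.2 - q.2) ^ 2 :=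
  Real.sq_sqrt (by positivity)

/-- cross product bound -/
lemma cross_le {a b c d α β : ℝ} (ha : |a| ≤ α) (hb : |b| ≤ α) (hc : |c| ≤ β) (hd : |d| ≤ β) :
    |a * d - b * c| ≤ 2 * (α * β) := by
  have h1 : |a * d| ≤ α * β := by
    rw [abs_mul]; exact mul_le_mul ha hd (abs_nonneg _) ((abs_nonneg _).trans ha)
  have h2 : |b * c| ≤ α * β := by
    rw [abs_mul]; exact mul_le_mul hb hc (abs_nonneg _) ((abs_nonneg _).trans ha)
  have := abs_sub (a * d) (b * c)
  linarith

set_option maxHeartbeats 4000000 in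
lemma ellipse_cross (x y w : ℝ × ℝ) (K : ℝ) (hK : 2 ≤ K)
    (h : e2 x w + e2 y w ≤ (1 + 2 / K ^ 2) * e2 x y) :
    |(w.1 - x.1) * (y.2 - x.2) - (w.2 - x.2) * (y.1 - x.1)| ≤ 2 * (e2 x y / K) * e2 x y := by
  have hs := e2_sq x w
  have ht := e2_sq y w
  have hN := e2_sq x y
  have hs0 : 0 ≤ e2 x w := Real.sqrt_nonneg _
  have ht0 : 0 ≤ e2 y w := Real.sqrt_nonneg _
  have hN0 : 0 ≤ e2 x y := Real.sqrt_nonneg _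
  set s := e2 x w
  set t := e2 y w
  set N := e2 x y
  apply abs_le_of_sq_le_sq _ (by positivity)
  have key : 4 * ((w.1 - x.1) * (y.2 - x.2) - (w.2 - x.2) * (y.1 - x.1)) ^ 2
      = ((s + t) ^ 2 - N ^ 2) * (N ^ 2 - (s - t) ^ 2) := by
    have e : ((s + t) ^ 2 - N ^ 2) * (N ^ 2 - (s - t) ^ 2)
      = 4 * s ^ 2 * N ^ 2 - (s ^ 2 + N ^ 2 - t ^ 2) ^ 2 := by ring
    rw [e, hs, ht, hN]; ring
  have hKi : 2 / K ^ 2 = 2 * (1 / K) ^ 2 := by field_simp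
  rw [hKi] at h
  have hdiv : N / K = N * (1 / K) := by ring
  rw [hdiv]
  have hi0 : 0 ≤ 1 / K := by positivity
  have hi1 : 1 / K ≤ 1 := by rw [div_le_one (by linarith)]; linarith
  set q := 1 / K
  have h1 : (s + t) ^ 2 - N ^ 2 ≤ 8 * q ^ 2 * N ^ 2 := by
    have : (s + t) ^ 2 ≤ ((1 + 2 * q ^ 2) * N) ^ 2 := pow_le_pow_left₀ (by positivity) h 2
    have hq : q ^ 2 ≤ 1 := by nlinarith
    nlinarith [mul_nonneg (mul_nonneg (sq_nonneg q) (sub_nonneg.2 hq)) (sq_nonneg N)]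
  have hN2 : 0 ≤ N ^ 2 := sq_nonneg _
  have h2 : ((s + t) ^ 2 - N ^ 2) * (N ^ 2 - (s - t) ^ 2) ≤ (8 * q ^ 2 * N ^ 2) * N ^ 2 := by
    rcases le_total 0 (N ^ 2 - (s - t) ^ 2) with h3 | h3
    · exact mul_le_mul h1 (by nlinarith [sq_nonneg (s - t)]) h3 (by positivity)
    · have h4 : 0 ≤ 4 * ((w.1 - x.1) * (y.2 - x.2) - (w.2 - x.2) * (y.1 - x.1)) ^ 2 := by
        positivity
      have h5 : N ^ 2 ≤ (s + t) ^ 2 := by nlinarith [mul_nonneg hs0 ht0]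
      exact le_trans (mul_nonpos_of_nonneg_of_nonpos (by linarith) h3) (by positivity)
  nlinarith [mul_nonneg (mul_nonneg (sq_nonneg q) hN2) hN2]

lemma box_diff {r : ℝ} {i : Z2} {p q : ℝ × ℝ} (hp : p ∈ BDbox r i) (hq : q ∈ BDbox r i) :
    |p.1 - q.1| ≤ r ∧ |p.2 - q.2| ≤ r := by
  obtain ⟨a1, a2, a3, a4⟩ := hp
  obtain ⟨b1, b2, b3, b4⟩ := hq
  constructor <;> rw [abs_le] <;> constructor <;> linarith

set_option maxHeartbeats 4000000 in
lemma strip (K j : ℕ) (hK : 2 ≤ K) (i₁ i₂ : Z2) (P₀ : GridPath) (h0 : P₀ ∈ SL K (j + 1))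
    (hx0 : P₀.start ∈ BDbox ((K : ℝ) ^ j / (K : ℝ)) i₁)
    (hy0 : P₀.fin ∈ BDbox ((K : ℝ) ^ j / (K : ℝ)) i₂) (p : ℝ × ℝ)
    (hp : p ∈ tameUnion K j i₁ i₂) :
    |(p.1 - P₀.start.1) * (P₀.fin.2 - P₀.start.2) - (p.2 - P₀.start.2) * (P₀.fin.1 - P₀.start.1)|
      ≤ 25 * ((K : ℝ) ^ j * P₀.norm) ∧
    |p.1 - P₀.start.1| ≤ 3 * (K * (K : ℝ) ^ j) ∧ |p.2 - P₀.start.2| ≤ 3 * (K * (K : ℝ) ^ j) := by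
  obtain ⟨P, hSL, hT, hx, hy, hpP⟩ := hp
  obtain ⟨w, hw, hpw⟩ := hT p hpP
  obtain ⟨n1, n2, n3⟩ := hSL
  obtain ⟨m1, m2, -⟩ := h0
  have hK' : (2 : ℝ) ≤ K := by exact_mod_cast hK
  have hxp : e2 P.start p ≤ P.norm := n3 hpP
  have hell := ellipse_cross P.start P.fin w K hK' hw
  change _ ≤ 2 * (P.norm / K) * P.norm at hell
  have hR1 : (1 : ℝ) ≤ (K : ℝ) ^ j := one_le_pow₀ (by linarith)
  have hr : (K : ℝ) * ((K : ℝ) ^ j / K) = (K : ℝ) ^ j := by field_simp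
  have hu : (1 + 1 / (K : ℝ)) * (K : ℝ) ^ (j + 1) = K * (K : ℝ) ^ j + (K : ℝ) ^ j := by
    rw [pow_succ]; field_simp
  rw [hu] at n2 m2
  have hpw' : (K : ℝ) ^ (j + 1) = K * (K : ℝ) ^ j := by ring
  rw [hpw'] at n1 m1
  have hr0 : 0 ≤ (K : ℝ) ^ j / K := by positivity
  obtain ⟨bx1, bx2⟩ := box_diff hx hx0
  obtain ⟨by1, by2⟩ := box_diff hy hy0
  have c1 := abs1_le_e2 P.start p
  have c2 := abs2_le_e2 P.start p
  have e1 := abs1_le_e2 p w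
  have e2' := abs2_le_e2 p w
  have d1 := abs1_le_e2 P.start P.fin
  have d2 := abs2_le_e2 P.start P.fin
  have f1 := abs1_le_e2 P₀.start P₀.fin
  have f2 := abs2_le_e2 P₀.start P₀.fin
  change _ ≤ P.norm at d1 d2
  change _ ≤ P₀.norm at f1 f2
  set R := (K : ℝ) ^ j
  set r := R / K
  set N := P.norm
  set N₀ := P₀.norm
  generalize P.start = x at *
  generalize P.fin = y at *
  generalize P₀.start = x0 at *
  generalize P₀.fin = y0 at *
  have hrR : r ≤ R := by nlinarith
  have hKR : 2 * R ≤ K * R := by nlinarith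
  have hN15 : N ≤ 3 / 2 * (K * R) := by linarith
  have hNK : N / K ≤ 3 / 2 * R := by
    rw [div_le_iff₀ (by linarith)]; linarith
  have hN0 : 0 ≤ N := by linarith
  have A1 : |(p.1 - w.1) * (y.2 - x.2) - (p.2 - w.2) * (y.1 - x.1)| ≤ 2 * ((4 * R) * N) :=
    cross_le (e1.trans hpw) (e2'.trans hpw) (by rw [abs_sub_comm]; exact d1)
      (by rw [abs_sub_comm]; exact d2)
  have A2 : |(p.1 - x.1) * ((y0.2 - y.2) - (x0.2 - x.2)) -
      (p.2 - x.2) * ((y0.1 - y.1) - (x0.1 - x.1))| ≤ 2 * (N * (2 * r)) := by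
    apply cross_le
    · rw [abs_sub_comm]; linarith
    · rw [abs_sub_comm]; linarith
    · rw [abs_le] at *; constructor <;> linarith
    · rw [abs_le] at *; constructor <;> linarith
  have A3 : |(x.1 - x0.1) * (y0.2 - x0.2) - (x.2 - x0.2) * (y0.1 - x0.1)| ≤ 2 * (r * N₀) :=
    cross_le bx1 bx2 (by rw [abs_sub_comm]; exact f1) (by rw [abs_sub_comm]; exact f2)
  have hNN : N ≤ 3 / 2 * N₀ := by linarith
  have B1 : 2 * ((4 * R) * N) ≤ 12 * (R * N₀) := by nlinarith
  have B2 : 2 * (N * (2 * r)) ≤ 6 * (R * N₀) := by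
    have : N * r ≤ 3 / 2 * (K * R) * r := mul_le_mul_of_nonneg_right hN15 hr0
    have h3 : 3 / 2 * (K * R) * r = 3 / 2 * (R * R) := by
      rw [show 3 / 2 * (K * R) * r = 3 / 2 * R * (K * r) by ring, hr]; ring
    nlinarith
  have B3 : 2 * (r * N₀) ≤ 2 * (R * N₀) := by nlinarith
  have B4 : 2 * (N / K) * N ≤ 5 * (R * N₀) := by
    have h5 : (N / K) * N ≤ 3 / 2 * R * (3 / 2 * N₀) :=
      mul_le_mul hNK hNN hN0 (by linarith)
    nlinarith
  refine ⟨?_, ?_, ?_⟩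
  · have e : (p.1 - x0.1) * (y0.2 - x0.2) - (p.2 - x0.2) * (y0.1 - x0.1) =
      ((w.1 - x.1) * (y.2 - x.2) - (w.2 - x.2) * (y.1 - x.1)) +
      ((p.1 - w.1) * (y.2 - x.2) - (p.2 - w.2) * (y.1 - x.1)) +
      ((p.1 - x.1) * ((y0.2 - y.2) - (x0.2 - x.2)) -
      (p.2 - x.2) * ((y0.1 - y.1) - (x0.1 - x.1))) +
      ((x.1 - x0.1) * (y0.2 - x0.2) - (x.2 - x0.2) * (y0.1 - x0.1)) := by ring
    rw [e]
    have := abs_le.1 hell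
    have := abs_le.1 A1
    have := abs_le.1 A2
    have := abs_le.1 A3
    rw [abs_le]; constructor <;> linarith
  · rw [abs_le] at *; constructor <;> linarith
  · rw [abs_le] at *; constructor <;> linarith

lemma cross_slope {a b d e M N : ℝ} (h : |a * e - b * d| ≤ M * N) (hed : |e| ≤ |d|)
    (hN : N ≤ |d| + |e|) (hN0 : 0 < N) (hM : 0 ≤ M) : |b| ≤ 2 * M + |a| := by
  have hd : 0 < |d| := by linarith
  have h1 : |b * d| ≤ |a * e| + |a * e - b * d| := by
    have := abs_sub (a * e) (a * e - b * d)
    simpa using this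
  rw [abs_mul, abs_mul] at h1
  have h2 : |a| * |e| ≤ |a| * |d| := mul_le_mul_of_nonneg_left hed (abs_nonneg _)
  have h3 : M * N ≤ M * (2 * |d|) := mul_le_mul_of_nonneg_left (by linarith) hM
  refine le_of_mul_le_mul_right ?_ hd
  linarith

lemma slopeA (K j : ℕ) (hK : 2 ≤ K) (i₁ i₂ : Z2) (hne : (tameUnion K j i₁ i₂).Nonempty) :
    ((∀ p ∈ tameUnion K j i₁ i₂, ∀ q ∈ tameUnion K j i₁ i₂,
        |p.2 - q.2| ≤ 100 * ((K : ℝ) ^ j + |p.1 - q.1|)) ∨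
     (∀ p ∈ tameUnion K j i₁ i₂, ∀ q ∈ tameUnion K j i₁ i₂,
        |p.1 - q.1| ≤ 100 * ((K : ℝ) ^ j + |p.2 - q.2|))) ∧
    (∀ p ∈ tameUnion K j i₁ i₂, ∀ q ∈ tameUnion K j i₁ i₂,
        |p.1 - q.1| ≤ 6 * (K * (K : ℝ) ^ j) ∧ |p.2 - q.2| ≤ 6 * (K * (K : ℝ) ^ j)) := by
  obtain ⟨_, P₀, h0, -, hx0, hy0, -⟩ := hne
  have hs := strip K j hK i₁ i₂ P₀ h0 hx0 hy0
  have hNle : P₀.norm ≤ _ := e2_le_add P₀.start P₀.fin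
  have hK' : (2 : ℝ) ≤ K := by exact_mod_cast hK
  have hR1 : (1 : ℝ) ≤ (K : ℝ) ^ j := one_le_pow₀ (by linarith)
  have hNpos : 0 < P₀.norm := lt_of_lt_of_le (by positivity) h0.1
  rw [abs_sub_comm P₀.start.1, abs_sub_comm P₀.start.2] at hNle
  constructor
  · rcases le_total |P₀.fin.2 - P₀.start.2| |P₀.fin.1 - P₀.start.1| with hc | hc
    · left
      intro p hp q hq
      have h1 := abs_le.1 (hs p hp).1
      have h2 := abs_le.1 (hs q hq).1
      have := cross_slope (a := p.1 - q.1) (b := p.2 - q.2) (d := P₀.fin.1 - P₀.start.1)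
        (e := P₀.fin.2 - P₀.start.2) (M := 50 * (K : ℝ) ^ j) (N := P₀.norm)
        (by rw [abs_le]; constructor <;> linarith) hc hNle hNpos (by positivity)
      linarith [abs_nonneg (p.1 - q.1)]
    · right
      intro p hp q hq
      have h1 := abs_le.1 (hs p hp).1
      have h2 := abs_le.1 (hs q hq).1
      have := cross_slope (a := p.2 - q.2) (b := p.1 - q.1) (e := P₀.fin.1 - P₀.start.1)
        (d := P₀.fin.2 - P₀.start.2) (M := 50 * (K : ℝ) ^ j) (N := P₀.norm)
        (by rw [abs_le]; constructor <;> linarith) hc (by linarith) hNpos (by positivity)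
      linarith [abs_nonneg (p.2 - q.2)]
  · intro p hp q hq
    obtain ⟨-, a1, a2⟩ := hs p hp
    obtain ⟨-, b1, b2⟩ := hs q hq
    rw [abs_le] at a1 a2 b1 b2
    constructor <;> rw [abs_le] <;> constructor <;> linarith

/-- Passing from points to box indices in one coordinate. -/
lemma idx_bounds {R i i' s s' : ℝ} (h1 : i * R - 1 / 2 ≤ s) (h2 : s ≤ (i + 1) * R - 1 / 2)
    (h3 : i' * R - 1 / 2 ≤ s') (h4 : s' ≤ (i' + 1) * R - 1 / 2) (hR : 0 < R) :
    |i - i'| * R ≤ |s - s'| + R ∧ |s - s'| ≤ |i - i'| * R + R := by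
  have e : |i - i'| * R = |(i - i') * R| := by rw [abs_mul, abs_of_pos hR]
  rw [e]
  have a := le_abs_self (s - s')
  have b := neg_abs_le (s - s')
  have c := le_abs_self ((i - i') * R)
  have d := neg_abs_le ((i - i') * R)
  constructor
  · rw [abs_le (a := (i - i') * R)]; constructor <;> linarith
  · rw [abs_le (a := s - s')]; constructor <;> linarith

lemma idx_slope {K R I I' S S' : ℝ} (hR : 1 ≤ R) (hK : 2 ≤ K) (hI0 : 0 ≤ I) (hI : I * R ≤ S + R)
    (hI' : I' * R ≤ S' + R) (hS : S ≤ I * R + R) :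
    (S' ≤ 100 * (R + S) → I' ≤ 201 * (1 + I)) ∧
    (S ≤ 6 * (K * R) → I ≤ 201 * (K * 1)) := by
  have hR0 : 0 < R := by linarith
  constructor
  · intro h
    by_contra hc
    push Not at hc
    have h0 : 0 ≤ I * R := mul_nonneg hI0 hR0.le
    have := mul_lt_mul_of_pos_right hc hR0
    linarith
  · intro h
    refine le_of_mul_le_mul_right ?_ hR0
    nlinarith

lemma card_eq {α : Type*} (s : Set α) : Nat.card s = s.ncard := rfl

/-- **Equation (4.2) (geometry of the union of tame paths).** There is a universal
constant `C > 0` such that for `K = 2^k ≥ 2`, `0 ≤ j ≤ m-2`, end-boxes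
`B₁, B₂ ∈ BD_{K^{j-1}}`, and `A` the (nonempty) union of all tame `P ∈ SL_{j+1}`
with `x_P ∈ B₁`, `y_P ∈ B₂`: (1) `|A ∩ ℤ²| ≤ C K^{2j+1}`; (2) the smaller of the
maximal column/row counts of `A ∩ ℤ²` is `≤ C K^j`; (3) at most `C K` boxes of
`BD_{K^j}` meet `A`; (4) the smaller of the maximal column/row counts of the
rescaled set `D̃` of lower-left corners (i.e. of the index set of boxes of
`BD_{K^j}` meeting `A`, since `K^{-j} l_B = (a,b)` for the box indexed by `(a,b)`)
is `≤ C`. -/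
theorem tame_union_geometry :
    ∃ C : ℝ, 0 < C ∧
      ∀ k K m : ℕ, K = 2 ^ k → 2 ≤ K →
        ∀ j : ℕ, j + 2 ≤ m →
          ∀ i₁ i₂ : Z2, (tameUnion K j i₁ i₂).Nonempty →
            ((Nat.card {z : Z2 | castZ z ∈ tameUnion K j i₁ i₂} : ℝ) ≤
                C * (K : ℝ) ^ (2 * j + 1)) ∧
            (((∀ a : ℤ, (Nat.card {z : Z2 | castZ z ∈ tameUnion K j i₁ i₂ ∧
                    z.1 = a} : ℝ) ≤ C * (K : ℝ) ^ j) ∨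
              (∀ b : ℤ, (Nat.card {z : Z2 | castZ z ∈ tameUnion K j i₁ i₂ ∧
                    z.2 = b} : ℝ) ≤ C * (K : ℝ) ^ j))) ∧
            ((Nat.card {i : Z2 |
                (BDbox ((K : ℝ) ^ j) i ∩ tameUnion K j i₁ i₂).Nonempty} : ℝ) ≤
              C * K) ∧
            (((∀ a : ℤ, (Nat.card {i : Z2 |
                    (BDbox ((K : ℝ) ^ j) i ∩ tameUnion K j i₁ i₂).Nonempty ∧
                    i.1 = a} : ℝ) ≤ C) ∨
              (∀ b : ℤ, (Nat.card {i : Z2 |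
                    (BDbox ((K : ℝ) ^ j) i ∩ tameUnion K j i₁ i₂).Nonempty ∧
                    i.2 = b} : ℝ) ≤ C))) := by
  refine ⟨200000, by norm_num, ?_⟩
  intro k K m _ hK j _ i₁ i₂ hne
  have hK' : (2 : ℝ) ≤ K := by exact_mod_cast hK
  have hR1 : (1 : ℝ) ≤ (K : ℝ) ^ j := one_le_pow₀ (by linarith)
  have hpow : (K : ℝ) ^ (2 * j + 1) = K * ((K : ℝ) ^ j) ^ 2 := by ring
  have hKR : 0 ≤ (K : ℝ) * (K : ℝ) ^ j := by positivity
  obtain ⟨hsl, hrg⟩ := slopeA K j hK i₁ i₂ hne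
  set A := tameUnion K j i₁ i₂
  rw [hpow]
  set R := (K : ℝ) ^ j
  rcases hsl with hsl | hsl
  · have L := count2 {z : Z2 | castZ z ∈ A} Prod.fst Prod.snd (fun z w h h' => Prod.ext h h')
      K R (by linarith) hR1
      (fun z hz w hw => by
        have := hsl _ hz _ hw
        simp only [castZ] at this
        linarith [abs_nonneg ((z.1 : ℝ) - w.1)])
      (fun z hz w hw => by
        have := (hrg _ hz _ hw).1
        simp only [castZ] at this
        linarith)
    have B := count2 {i : Z2 | (BDbox R i ∩ A).Nonempty} Prod.fst Prod.snd
      (fun z w h h' => Prod.ext h h') K 1 (by linarith) le_rfl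
      (fun z hz w hw => by
        obtain ⟨p, ⟨p1, p2, p3, p4⟩, hp⟩ := hz
        obtain ⟨q, ⟨q1, q2, q3, q4⟩, hq⟩ := hw
        have x1 := idx_bounds p1 p2 q1 q2 (by linarith)
        have x2 := idx_bounds p3 p4 q3 q4 (by linarith)
        exact (idx_slope hR1 hK' (abs_nonneg _) x1.1 x2.1 x1.2).1 (hsl p hp q hq))
      (fun z hz w hw => by
        obtain ⟨p, ⟨p1, p2, p3, p4⟩, hp⟩ := hz
        obtain ⟨q, ⟨q1, q2, q3, q4⟩, hq⟩ := hw
        have x1 := idx_bounds p1 p2 q1 q2 (by linarith)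
        exact (idx_slope hR1 hK' (abs_nonneg _) x1.1 x1.1 x1.2).2 (hrg p hp q hq).1)
    refine ⟨L.1, Or.inl L.2, ?_, Or.inl fun a => ?_⟩
    · have := B.1
      rw [one_pow, mul_one] at this
      exact this
    · have := B.2 a
      rw [mul_one] at this
      exact this
  · have L := count2 {z : Z2 | castZ z ∈ A} Prod.snd Prod.fst (fun z w h h' => Prod.ext h' h)
      K R (by linarith) hR1
      (fun z hz w hw => by
        have := hsl _ hz _ hw
        simp only [castZ] at this
        linarith [abs_nonneg ((z.2 : ℝ) - w.2)])
      (fun z hz w hw => by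
        have := (hrg _ hz _ hw).2
        simp only [castZ] at this
        linarith)
    have B := count2 {i : Z2 | (BDbox R i ∩ A).Nonempty} Prod.snd Prod.fst
      (fun z w h h' => Prod.ext h' h) K 1 (by linarith) le_rfl
      (fun z hz w hw => by
        obtain ⟨p, ⟨p1, p2, p3, p4⟩, hp⟩ := hz
        obtain ⟨q, ⟨q1, q2, q3, q4⟩, hq⟩ := hw
        have x1 := idx_bounds p1 p2 q1 q2 (by linarith)
        have x2 := idx_bounds p3 p4 q3 q4 (by linarith)
        exact (idx_slope hR1 hK' (abs_nonneg _) x2.1 x1.1 x2.2).1 (hsl p hp q hq))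
      (fun z hz w hw => by
        obtain ⟨p, ⟨p1, p2, p3, p4⟩, hp⟩ := hz
        obtain ⟨q, ⟨q1, q2, q3, q4⟩, hq⟩ := hw
        have x2 := idx_bounds p3 p4 q3 q4 (by linarith)
        exact (idx_slope hR1 hK' (abs_nonneg _) x2.1 x2.1 x2.2).2 (hrg p hp q hq).2)
    refine ⟨L.1, Or.inr L.2, ?_, Or.inr fun a => ?_⟩
    · have := B.1
      rw [one_pow, mul_one] at this
      exact this
    · have := B.2 a
      rw [mul_one] at this
      exact this
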